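/- arXiv:2311.09255 — 8 statements merged into one kernel-verified Lean document; each statement's English description precedes it below -/
import Mathlib

section
/- For all K, L_u, L_s, P > 0 fixed and all G > 0, the derivative of the skill premium w_s/w_u with respect to G equals [φ·β₂(1−β₂)(1−β₃)·(γ/φ − 1)/(β₁β₃)] · G^{φ−1} · L_s^{φ−1} · L_u^{1−θ} · (β₁ L_u^θ + (1−β₁) P^θ)^{1 − γ/θ} · (β₂ L_s^φ + (1−β₂) G^φ)^{γ/φ − 2}. -/
open Real

/-- The nested CES production function. All powers are real powers (`rpow`). -/
noncomputable def Y (α β₁ β₂ β₃ γ θ φ K Lu Ls P G : ℝ) : ℝ :=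
  K ^ α *
    (β₃ * (β₁ * Lu ^ θ + (1 - β₁) * P ^ θ) ^ (γ / θ) +
      (1 - β₃) * (β₂ * Ls ^ φ + (1 - β₂) * G ^ φ) ^ (γ / φ)) ^ ((1 - α) / γ)

/-- The skill premium `w_s / w_u` viewed as a function of the AI stock `G`, with
`K`, `L_u`, `L_s`, `P` held fixed.  Here `w_s` is the partial derivative of `Y` with
respect to `L_s` and `w_u` is the partial derivative of `Y` with respect to `L_u`. -/
noncomputable def skillPremium (α β₁ β₂ β₃ γ θ φ K Lu Ls P : ℝ) : ℝ → ℝ := fun G =>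
  deriv (fun x => Y α β₁ β₂ β₃ γ θ φ K Lu x P G) Ls /
    deriv (fun x => Y α β₁ β₂ β₃ γ θ φ K x Ls P G) Lu

theorem aux_hasDerivAt (k p q b c t g e x : ℝ) (hp : 0 < p) (hq : 0 < q) (hb : 0 < b)
    (hc : 0 < c) (ht : 0 < t) (hx : 0 < x) :
    HasDerivAt (fun x : ℝ => k * (p * (b * x ^ t + c) ^ (g / t) + q) ^ e)
      (k * e * (p * (b * x ^ t + c) ^ (g / t) + q) ^ (e - 1) * g *
        (p * b * x ^ (t - 1) * (b * x ^ t + c) ^ (g / t - 1))) x := by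
  have hA : 0 < b * x ^ t + c := by positivity
  have hS : 0 < p * (b * x ^ t + c) ^ (g / t) + q := by positivity
  have h1 : HasDerivAt (fun x : ℝ => b * x ^ t + c) (b * (t * x ^ (t - 1))) x :=
    ((Real.hasDerivAt_rpow_const (Or.inl hx.ne')).const_mul b).add_const c
  have h2 := ((h1.rpow_const (p := g / t) (Or.inl hA.ne')).const_mul p).add_const q
  have h3 := (h2.rpow_const (p := e) (Or.inl hS.ne')).const_mul k
  refine h3.congr_deriv ?_
  field_simp

/-- The derivative of the skill premium with respect to the AI stock `G` equals the
closed-form expression in Equation (4) of the paper. -/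
theorem deriv_skill_premium_formula
    (α β₁ β₂ β₃ γ θ φ : ℝ)
(hα : 0 < α) (hα1 : α < 1)
    (hβ₁ : 0 < β₁) (hβ₁1 : β₁ < 1)
    (hβ₂ : 0 < β₂) (hβ₂1 : β₂ < 1)
    (hβ₃ : 0 < β₃) (hβ₃1 : β₃ < 1)
    (hγ : 0 < γ) (hγ1 : γ ≤ 1)
    (hθ : 0 < θ) (hθ1 : θ ≤ 1)
    (hφ : 0 < φ) (hφ1 : φ ≤ 1)
    (K Lu Ls P G : ℝ)
    (hK : 0 < K) (hLu : 0 < Lu) (hLs : 0 < Ls) (hP : 0 < P) (hG : 0 < G) :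
    deriv (skillPremium α β₁ β₂ β₃ γ θ φ K Lu Ls P) G =
      φ * β₂ * (1 - β₂) * (1 - β₃) * (γ / φ - 1) / (β₁ * β₃) *
        G ^ (φ - 1) * Ls ^ (φ - 1) * Lu ^ (1 - θ) *
        (β₁ * Lu ^ θ + (1 - β₁) * P ^ θ) ^ (1 - γ / θ) *
        (β₂ * Ls ^ φ + (1 - β₂) * G ^ φ) ^ (γ / φ - 2) := by
  have b1 : 0 < 1 - β₁ := by linarith
  have b2 : 0 < 1 - β₂ := by linarith
  have b3 : 0 < 1 - β₃ := by linarith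
  have a1 : 0 < 1 - α := by linarith
  have hA : 0 < β₁ * Lu ^ θ + (1 - β₁) * P ^ θ := by positivity
  have key : ∀ H : ℝ, 0 < H → skillPremium α β₁ β₂ β₃ γ θ φ K Lu Ls P H =
      ((1 - β₃) * β₂ / (β₁ * β₃) * Ls ^ (φ - 1) * Lu ^ (1 - θ) *
        (β₁ * Lu ^ θ + (1 - β₁) * P ^ θ) ^ (1 - γ / θ)) *
        (β₂ * Ls ^ φ + (1 - β₂) * H ^ φ) ^ (γ / φ - 1) := by
    intro H hH
    have hB : 0 < β₂ * Ls ^ φ + (1 - β₂) * H ^ φ := by positivity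
    have d1 := (aux_hasDerivAt (K ^ α) β₃
      ((1 - β₃) * (β₂ * Ls ^ φ + (1 - β₂) * H ^ φ) ^ (γ / φ)) β₁ ((1 - β₁) * P ^ θ) θ γ
      ((1 - α) / γ) Lu hβ₃ (by positivity) hβ₁ (by positivity) hθ hLu).deriv
    have d2 := (aux_hasDerivAt (K ^ α) (1 - β₃)
      (β₃ * (β₁ * Lu ^ θ + (1 - β₁) * P ^ θ) ^ (γ / θ)) β₂ ((1 - β₂) * H ^ φ) φ γ
      ((1 - α) / γ) Ls b3 (by positivity) hβ₂ (by positivity) hφ hLs).deriv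
    have e2 : (fun x => Y α β₁ β₂ β₃ γ θ φ K Lu x P H) = fun x : ℝ => K ^ α *
        ((1 - β₃) * (β₂ * x ^ φ + (1 - β₂) * H ^ φ) ^ (γ / φ) +
          β₃ * (β₁ * Lu ^ θ + (1 - β₁) * P ^ θ) ^ (γ / θ)) ^ ((1 - α) / γ) := by
      funext x
      simp only [Y]
      rw [add_comm (β₃ * _)]
    have r1 : Lu ^ (1 - θ) = (Lu ^ (θ - 1))⁻¹ := by
      rw [← Real.rpow_neg hLu.le, neg_sub]
    have r2 : (β₁ * Lu ^ θ + (1 - β₁) * P ^ θ) ^ (1 - γ / θ) =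
        ((β₁ * Lu ^ θ + (1 - β₁) * P ^ θ) ^ (γ / θ - 1))⁻¹ := by
      rw [← Real.rpow_neg hA.le, neg_sub]
    unfold skillPremium
    simp only [e2]
    rw [d2]
    simp only [Y]
    rw [d1, add_comm ((1 - β₃) * _), r1, r2]
    have hS : 0 < β₃ * (β₁ * Lu ^ θ + (1 - β₁) * P ^ θ) ^ (γ / θ) +
      (1 - β₃) * (β₂ * Ls ^ φ + (1 - β₂) * H ^ φ) ^ (γ / φ) := by positivity
    have hS' := Real.rpow_pos_of_pos hS ((1 - α) / γ - 1)
    have hA' := Real.rpow_pos_of_pos hA (γ / θ - 1)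
    have hL' := Real.rpow_pos_of_pos hLu (θ - 1)
    have hK' := Real.rpow_pos_of_pos hK α
    have hC : K ^ α * ((1 - α) / γ) * (β₃ * (β₁ * Lu ^ θ + (1 - β₁) * P ^ θ) ^ (γ / θ) +
      (1 - β₃) * (β₂ * Ls ^ φ + (1 - β₂) * H ^ φ) ^ (γ / φ)) ^ ((1 - α) / γ - 1) * γ ≠ 0 := by
      positivity
    rw [mul_div_mul_left _ _ hC]
    generalize (β₁ * Lu ^ θ + (1 - β₁) * P ^ θ) ^ (γ / θ - 1) = A at *
    generalize (β₂ * Ls ^ φ + (1 - β₂) * H ^ φ) ^ (γ / φ - 1) = B at *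
    generalize Lu ^ (θ - 1) = L at *
    generalize Ls ^ (φ - 1) = M at *
    field_simp
  have hev : skillPremium α β₁ β₂ β₃ γ θ φ K Lu Ls P =ᶠ[nhds G] fun H =>
      ((1 - β₃) * β₂ / (β₁ * β₃) * Ls ^ (φ - 1) * Lu ^ (1 - θ) *
        (β₁ * Lu ^ θ + (1 - β₁) * P ^ θ) ^ (1 - γ / θ)) *
        (β₂ * Ls ^ φ + (1 - β₂) * H ^ φ) ^ (γ / φ - 1) := by
    filter_upwards [lt_mem_nhds hG] with H hH using key H hH
  rw [hev.deriv_eq]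
  have hB : 0 < β₂ * Ls ^ φ + (1 - β₂) * G ^ φ := by positivity
  have h1 : HasDerivAt (fun x : ℝ => β₂ * Ls ^ φ + (1 - β₂) * x ^ φ)
      ((1 - β₂) * (φ * G ^ (φ - 1))) G :=
    ((Real.hasDerivAt_rpow_const (Or.inl hG.ne')).const_mul (1 - β₂)).const_add _
  have h2 := (h1.rpow_const (p := γ / φ - 1) (Or.inl hB.ne')).const_mul
    ((1 - β₃) * β₂ / (β₁ * β₃) * Ls ^ (φ - 1) * Lu ^ (1 - θ) *
        (β₁ * Lu ^ θ + (1 - β₁) * P ^ θ) ^ (1 - γ / θ))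
  rw [h2.deriv, show γ / φ - 1 - 1 = γ / φ - 2 by ring]
  ring
end

section
/- (Proposition 1) Suppose γ < φ. Then for all fixed K, L_u, L_s, P > 0, the derivative of the skill premium w_s/w_u with respect to G is strictly negative at every G > 0; i.e., the growing use of AI reduces the skill premium. -/
open Real

/-- Derivative of the nested CES aggregate in one labor input. -/
lemma ces_deriv (c A b β D g t e L : ℝ) (hL : 0 < L) (hD : 0 < D) (hβ : 0 < β)
    (hb : 0 < b) (hA : 0 < A) :
    deriv (fun x => c * (A + b * (β * x ^ t + D) ^ g) ^ e) L =
      (c * e * (A + b * (β * L ^ t + D) ^ g) ^ (e - 1)) *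
        (b * β * t * g * L ^ (t - 1) * (β * L ^ t + D) ^ (g - 1)) := by
  have hS : 0 < β * L ^ t + D := by positivity
  have hT : 0 < A + b * (β * L ^ t + D) ^ g := by positivity
  have h1 : HasDerivAt (fun x : ℝ => x ^ t) (t * L ^ (t - 1)) L :=
    Real.hasDerivAt_rpow_const (Or.inl hL.ne')
  have h2 := ((h1.const_mul β).add_const D).rpow_const (p := g) (Or.inl hS.ne')
  have h3 := ((h2.const_mul b).const_add A).rpow_const (p := e) (Or.inl hT.ne')
  rw [(h3.const_mul c).deriv]
  ring

/-- Proposition 1: if `γ < φ` (AI is more substitutable for high-skill workers than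
low-skill workers are for high-skill workers), then the growing use of AI reduces the
skill premium: its derivative with respect to `G` is strictly negative at every `G > 0`. -/
theorem skill_premium_decreasing_in_AI
    (α β₁ β₂ β₃ γ θ φ : ℝ)
(hα : 0 < α) (hα1 : α < 1)
    (hβ₁ : 0 < β₁) (hβ₁1 : β₁ < 1)
    (hβ₂ : 0 < β₂) (hβ₂1 : β₂ < 1)
    (hβ₃ : 0 < β₃) (hβ₃1 : β₃ < 1)
    (hγ : 0 < γ) (hγ1 : γ ≤ 1)
    (hθ : 0 < θ) (hθ1 : θ ≤ 1)
    (hφ : 0 < φ) (hφ1 : φ ≤ 1)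
    (hγφ : γ < φ)
    (K Lu Ls P : ℝ)
    (hK : 0 < K) (hLu : 0 < Lu) (hLs : 0 < Ls) (hP : 0 < P) :
    ∀ G : ℝ, 0 < G →
      deriv (skillPremium α β₁ β₂ β₃ γ θ φ K Lu Ls P) G < 0 := by
  intro G hG
  have h1 : 0 < 1 - β₁ := by linarith
  have h2 : 0 < 1 - β₂ := by linarith
  have h3 : 0 < 1 - β₃ := by linarith
  have h4 : 0 < 1 - α := by linarith
  obtain ⟨C, hC, hform⟩ : ∃ C : ℝ, 0 < C ∧ ∀ H : ℝ, 0 < H →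
      skillPremium α β₁ β₂ β₃ γ θ φ K Lu Ls P H =
        C * (β₂ * Ls ^ φ + (1 - β₂) * H ^ φ) ^ (γ / φ - 1) := by
    refine ⟨((1 - β₃) * β₂ * φ * (γ / φ) * Ls ^ (φ - 1)) /
      (β₃ * β₁ * θ * (γ / θ) * Lu ^ (θ - 1) *
        (β₁ * Lu ^ θ + (1 - β₁) * P ^ θ) ^ (γ / θ - 1)), by positivity, ?_⟩
    intro H hH
    have e1 := ces_deriv (K ^ α) (β₃ * (β₁ * Lu ^ θ + (1 - β₁) * P ^ θ) ^ (γ / θ)) (1 - β₃) β₂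
      ((1 - β₂) * H ^ φ) (γ / φ) φ ((1 - α) / γ) Ls hLs (by positivity) hβ₂ h3 (by positivity)
    have e2 := ces_deriv (K ^ α) ((1 - β₃) * (β₂ * Ls ^ φ + (1 - β₂) * H ^ φ) ^ (γ / φ)) β₃ β₁
      ((1 - β₁) * P ^ θ) (γ / θ) θ ((1 - α) / γ) Lu hLu (by positivity) hβ₁ hβ₃ (by positivity)
    have e3 : (fun x => Y α β₁ β₂ β₃ γ θ φ K x Ls P H) = fun x => K ^ α *
        ((1 - β₃) * (β₂ * Ls ^ φ + (1 - β₂) * H ^ φ) ^ (γ / φ) +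
          β₃ * (β₁ * x ^ θ + (1 - β₁) * P ^ θ) ^ (γ / θ)) ^ ((1 - α) / γ) := by
      funext x
      rw [Y, add_comm (β₃ * _)]
    unfold skillPremium
    rw [e3, e2]
    unfold Y
    rw [e1, add_comm ((1 - β₃) * _) (β₃ * _), mul_div_mul_left, div_mul_eq_mul_div]
    positivity
  have hS : 0 < β₂ * Ls ^ φ + (1 - β₂) * G ^ φ := by positivity
  have hd1 : HasDerivAt (fun x : ℝ => x ^ φ) (φ * G ^ (φ - 1)) G :=
    Real.hasDerivAt_rpow_const (Or.inl hG.ne')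
  have hd := (((hd1.const_mul (1 - β₂)).const_add (β₂ * Ls ^ φ)).rpow_const
    (p := γ / φ - 1) (Or.inl hS.ne')).const_mul C
  have heq : skillPremium α β₁ β₂ β₃ γ θ φ K Lu Ls P =ᶠ[nhds G]
      fun H => C * (β₂ * Ls ^ φ + (1 - β₂) * H ^ φ) ^ (γ / φ - 1) := by
    filter_upwards [lt_mem_nhds hG] with H hH using hform H hH
  rw [heq.deriv_eq, hd.deriv]
  have hneg : 0 < 1 - γ / φ := by
    have := (div_lt_one hφ).2 hγφ
    linarith
  have hpos : 0 < C * ((1 - β₂) * (φ * G ^ (φ - 1)) * (1 - γ / φ) *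
      (β₂ * Ls ^ φ + (1 - β₂) * G ^ φ) ^ (γ / φ - 1 - 1)) := by positivity
  linarith
end

section
/- For fixed K, L_u, L_s, P > 0 and any G > 0, the derivative of the skill premium w_s/w_u with respect to G is strictly negative if and only if γ < φ; i.e., the sign of ∂(w_s/w_u)/∂G is exactly the sign of γ/φ − 1, independently of the values of β₁, β₂, β₃, K, L_u, L_s, P, G. -/
open Real

lemma ces_hasDerivAt (k c d b e φ p q x : ℝ) (hc : 0 < c) (hd : 0 < d) (hb : 0 < b)
    (he : 0 < e) (hx : 0 < x) :
    HasDerivAt (fun x : ℝ => k * (c + d * (b * x ^ φ + e) ^ p) ^ q)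
      (k * (d * (b * (φ * x ^ (φ - 1)) * p * (b * x ^ φ + e) ^ (p - 1)) * q *
        (c + d * (b * x ^ φ + e) ^ p) ^ (q - 1))) x := by
  have h1 : HasDerivAt (fun x : ℝ => b * x ^ φ + e) (b * (φ * x ^ (φ - 1))) x :=
    ((Real.hasDerivAt_rpow_const (Or.inl hx.ne')).const_mul b).add_const e
  have hB : 0 < b * x ^ φ + e := by positivity
  have h2 := h1.rpow_const (p := p) (Or.inl hB.ne')
  have h3 := (h2.const_mul d).const_add c
  have hS : 0 < c + d * (b * x ^ φ + e) ^ p := by positivity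
  exact (h3.rpow_const (p := q) (Or.inl hS.ne')).const_mul k

lemma skillPremium_eq
    (α β₁ β₂ β₃ γ θ φ : ℝ) (hα1 : α < 1)
    (hβ₁ : 0 < β₁) (hβ₁1 : β₁ < 1)
    (hβ₂ : 0 < β₂) (hβ₂1 : β₂ < 1)
    (hβ₃ : 0 < β₃) (hβ₃1 : β₃ < 1)
    (hγ : 0 < γ) (hθ : 0 < θ) (hφ : 0 < φ)
    (K Lu Ls P G : ℝ)
    (hK : 0 < K) (hLu : 0 < Lu) (hLs : 0 < Ls) (hP : 0 < P) (hG : 0 < G) :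
    skillPremium α β₁ β₂ β₃ γ θ φ K Lu Ls P G =
      ((1 - β₃) * β₂ * Ls ^ (φ - 1)) /
        (β₃ * β₁ * Lu ^ (θ - 1) * (β₁ * Lu ^ θ + (1 - β₁) * P ^ θ) ^ (γ / θ - 1)) *
      (β₂ * Ls ^ φ + (1 - β₂) * G ^ φ) ^ (γ / φ - 1) := by
  have e1 : 0 < 1 - β₁ := by linarith
  have e2 : 0 < 1 - β₂ := by linarith
  have e3 : 0 < 1 - β₃ := by linarith
  have e4 : 0 < 1 - α := by linarith
  have hs := ces_hasDerivAt (K ^ α) (β₃ * (β₁ * Lu ^ θ + (1 - β₁) * P ^ θ) ^ (γ / θ)) (1 - β₃) β₂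
    ((1 - β₂) * G ^ φ) φ (γ / φ) ((1 - α) / γ) Ls (by positivity) e3 hβ₂ (by positivity) hLs
  have hu := ces_hasDerivAt (K ^ α) ((1 - β₃) * (β₂ * Ls ^ φ + (1 - β₂) * G ^ φ) ^ (γ / φ)) β₃ β₁
    ((1 - β₁) * P ^ θ) θ (γ / θ) ((1 - α) / γ) Lu (by positivity) hβ₃ hβ₁ (by positivity) hLu
  have hf : (fun x => Y α β₁ β₂ β₃ γ θ φ K x Ls P G) = fun x =>
      K ^ α * ((1 - β₃) * (β₂ * Ls ^ φ + (1 - β₂) * G ^ φ) ^ (γ / φ) +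
        β₃ * (β₁ * x ^ θ + (1 - β₁) * P ^ θ) ^ (γ / θ)) ^ ((1 - α) / γ) := by
    funext x
    unfold Y
    rw [add_comm (β₃ * _)]
  have hs' : deriv (fun x => Y α β₁ β₂ β₃ γ θ φ K Lu x P G) Ls = _ := hs.deriv
  unfold skillPremium
  rw [hs', hf, hu.deriv,
    add_comm ((1 - β₃) * (β₂ * Ls ^ φ + (1 - β₂) * G ^ φ) ^ (γ / φ))]
  clear hs hu hs' hf
  have hA : 0 < (β₁ * Lu ^ θ + (1 - β₁) * P ^ θ) := by positivity
  have hB : 0 < (β₂ * Ls ^ φ + (1 - β₂) * G ^ φ) := by positivity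
  generalize (β₁ * Lu ^ θ + (1 - β₁) * P ^ θ) = A at *
  generalize (β₂ * Ls ^ φ + (1 - β₂) * G ^ φ) = B at *
  have hS : 0 < (β₃ * A ^ (γ / θ) + (1 - β₃) * B ^ (γ / φ)) ^ ((1 - α) / γ - 1) := by positivity
  generalize (β₃ * A ^ (γ / θ) + (1 - β₃) * B ^ (γ / φ)) ^ ((1 - α) / γ - 1) = S at *
  have h1 : 0 < A ^ (γ / θ - 1) := by positivity
  generalize A ^ (γ / θ - 1) = a at *
  generalize B ^ (γ / φ - 1) = b at *
  have h2 : 0 < Lu ^ (θ - 1) := by positivity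
  generalize Lu ^ (θ - 1) = l at *
  generalize Ls ^ (φ - 1) = m at *
  have h3 : 0 < K ^ α := by positivity
  generalize K ^ α = k at *
  field_simp

/-- The sign of `∂(w_s/w_u)/∂G` is exactly the sign of `γ/φ - 1`: the derivative of
the skill premium with respect to `G` is strictly negative if and only if `γ < φ`,
independently of the values of `β₁, β₂, β₃, K, L_u, L_s, P, G`. -/
theorem deriv_skill_premium_neg_iff
    (α β₁ β₂ β₃ γ θ φ : ℝ)
(hα : 0 < α) (hα1 : α < 1)
    (hβ₁ : 0 < β₁) (hβ₁1 : β₁ < 1)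
    (hβ₂ : 0 < β₂) (hβ₂1 : β₂ < 1)
    (hβ₃ : 0 < β₃) (hβ₃1 : β₃ < 1)
    (hγ : 0 < γ) (hγ1 : γ ≤ 1)
    (hθ : 0 < θ) (hθ1 : θ ≤ 1)
    (hφ : 0 < φ) (hφ1 : φ ≤ 1)
    (K Lu Ls P G : ℝ)
    (hK : 0 < K) (hLu : 0 < Lu) (hLs : 0 < Ls) (hP : 0 < P) (hG : 0 < G) :
    deriv (skillPremium α β₁ β₂ β₃ γ θ φ K Lu Ls P) G < 0 ↔ γ < φ := by

  have e1 : 0 < 1 - β₁ := by linarith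
  have e2 : 0 < 1 - β₂ := by linarith
  have e3 : 0 < 1 - β₃ := by linarith
  obtain ⟨C, hC, hCe⟩ : ∃ C : ℝ, 0 < C ∧ ∀ g : ℝ, 0 < g →
      skillPremium α β₁ β₂ β₃ γ θ φ K Lu Ls P g =
        C * (β₂ * Ls ^ φ + (1 - β₂) * g ^ φ) ^ (γ / φ - 1) :=
    ⟨_, by positivity, fun g hg => skillPremium_eq α β₁ β₂ β₃ γ θ φ hα1 hβ₁ hβ₁1 hβ₂ hβ₂1 hβ₃ hβ₃1
      hγ hθ hφ K Lu Ls P g hK hLu hLs hP hg⟩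
  have hev : skillPremium α β₁ β₂ β₃ γ θ φ K Lu Ls P =ᶠ[nhds G]
      fun g => C * (β₂ * Ls ^ φ + (1 - β₂) * g ^ φ) ^ (γ / φ - 1) := by
    filter_upwards [lt_mem_nhds hG] with g hg using hCe g hg
  have h1 : HasDerivAt (fun g : ℝ => β₂ * Ls ^ φ + (1 - β₂) * g ^ φ)
      ((1 - β₂) * (φ * G ^ (φ - 1))) G :=
    ((Real.hasDerivAt_rpow_const (Or.inl hG.ne')).const_mul (1 - β₂)).const_add _
  have hB : 0 < β₂ * Ls ^ φ + (1 - β₂) * G ^ φ := by positivity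
  have h2 := (h1.rpow_const (p := γ / φ - 1) (Or.inl hB.ne')).const_mul C
  rw [hev.deriv_eq, h2.deriv]
  have hD : 0 < C * ((1 - β₂) * (φ * G ^ (φ - 1))) *
      (β₂ * Ls ^ φ + (1 - β₂) * G ^ φ) ^ (γ / φ - 1 - 1) := by positivity
  have hre : C * ((1 - β₂) * (φ * G ^ (φ - 1)) * (γ / φ - 1) *
      (β₂ * Ls ^ φ + (1 - β₂) * G ^ φ) ^ (γ / φ - 1 - 1)) =
      (C * ((1 - β₂) * (φ * G ^ (φ - 1))) *
      (β₂ * Ls ^ φ + (1 - β₂) * G ^ φ) ^ (γ / φ - 1 - 1)) * (γ / φ - 1) := by ring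
  rw [hre, ← div_lt_one hφ]
  constructor
  · intro h
    by_contra hn
    have := mul_nonneg hD.le (sub_nonneg.2 (not_lt.1 hn))
    linarith
  · intro h
    exact mul_neg_of_pos_of_neg hD (sub_neg.2 h)
end

section
/- (Remark) If γ = φ, then the skill premium w_s/w_u is constant as a function of G: for all fixed K, L_u, L_s, P > 0 and all G, G' > 0, the skill premium evaluated at G equals the skill premium evaluated at G'; equivalently, its derivative with respect to G vanishes everywhere on (0, ∞). -/
open Real

/-- Closed form of the skill premium when the two exponents agree. -/
theorem skillPremium_closed (α β₁ β₂ β₃ θ φ : ℝ)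
    (hα1 : α < 1)
    (hβ₁ : 0 < β₁) (hβ₁1 : β₁ < 1)
    (hβ₂ : 0 < β₂) (hβ₂1 : β₂ < 1)
    (hβ₃ : 0 < β₃) (hβ₃1 : β₃ < 1)
    (hφ : 0 < φ)
    (K Lu Ls P G : ℝ)
    (hK : 0 < K) (hLu : 0 < Lu) (hLs : 0 < Ls) (hP : 0 < P) (hG : 0 < G) :
    skillPremium α β₁ β₂ β₃ φ θ φ K Lu Ls P G =
      ((1 - β₃) * (β₂ * (φ * Ls ^ (φ - 1)))) /
        (β₃ * (β₁ * (θ * Lu ^ (θ - 1)) * (φ / θ) *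
          (β₁ * Lu ^ θ + (1 - β₁) * P ^ θ) ^ (φ / θ - 1))) := by
  have h1 : 0 < 1 - β₁ := by linarith
  have h2 : 0 < 1 - β₂ := by linarith
  have h3 : 0 < 1 - β₃ := by linarith
  have h4 : 0 < 1 - α := by linarith
  have hA : 0 < β₁ * Lu ^ θ + (1 - β₁) * P ^ θ := by positivity
  have hB : 0 < β₃ * (β₁ * Lu ^ θ + (1 - β₁) * P ^ θ) ^ (φ / θ) +
      (1 - β₃) * (β₂ * Ls ^ φ + (1 - β₂) * G ^ φ) := by positivity
  have hone : φ / φ = 1 := div_self hφ.ne'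
  have dLs : HasDerivAt (fun x : ℝ => x ^ φ) (φ * Ls ^ (φ - 1)) Ls :=
    Real.hasDerivAt_rpow_const (Or.inl hLs.ne')
  have dLu : HasDerivAt (fun x : ℝ => x ^ θ) (θ * Lu ^ (θ - 1)) Lu :=
    Real.hasDerivAt_rpow_const (Or.inl hLu.ne')
  have ds := (((((dLs.const_mul β₂).add_const ((1 - β₂) * G ^ φ)).const_mul (1 - β₃)).const_add
    (β₃ * (β₁ * Lu ^ θ + (1 - β₁) * P ^ θ) ^ (φ / θ))).rpow_const
    (p := (1 - α) / φ) (Or.inl hB.ne')).const_mul (K ^ α)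
  have du := ((((((dLu.const_mul β₁).add_const ((1 - β₁) * P ^ θ)).rpow_const
    (p := φ / θ) (Or.inl hA.ne')).const_mul β₃).add_const
    ((1 - β₃) * (β₂ * Ls ^ φ + (1 - β₂) * G ^ φ))).rpow_const
    (p := (1 - α) / φ) (Or.inl hB.ne')).const_mul (K ^ α)
  unfold skillPremium Y
  simp only [hone, Real.rpow_one]
  rw [ds.deriv, du.deriv]
  have hE := Real.rpow_pos_of_pos hB ((1 - α) / φ - 1)
  have hC : K ^ α * ((1 - α) / φ * (β₃ * (β₁ * Lu ^ θ + (1 - β₁) * P ^ θ) ^ (φ / θ) +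
      (1 - β₃) * (β₂ * Ls ^ φ + (1 - β₂) * G ^ φ)) ^ ((1 - α) / φ - 1)) ≠ 0 := by
    have := Real.rpow_pos_of_pos hK α
    positivity
  refine Eq.trans ?_ (mul_div_mul_left _ _ hC)
  congr 1 <;> ring

/-- Remark: if `γ = φ` (AI is equally substitutable for high-skill workers as low-skill
workers are), then the skill premium is constant as a function of `G`: it takes the same
value at any two points `G, G' > 0`, and equivalently its derivative with respect to `G`
vanishes everywhere on `(0, ∞)`. -/
theorem skill_premium_constant_of_eq
    (α β₁ β₂ β₃ γ θ φ : ℝ)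
(hα : 0 < α) (hα1 : α < 1)
    (hβ₁ : 0 < β₁) (hβ₁1 : β₁ < 1)
    (hβ₂ : 0 < β₂) (hβ₂1 : β₂ < 1)
    (hβ₃ : 0 < β₃) (hβ₃1 : β₃ < 1)
    (hγ : 0 < γ) (hγ1 : γ ≤ 1)
    (hθ : 0 < θ) (hθ1 : θ ≤ 1)
    (hφ : 0 < φ) (hφ1 : φ ≤ 1)
    (hγφ : γ = φ)
    (K Lu Ls P : ℝ)
    (hK : 0 < K) (hLu : 0 < Lu) (hLs : 0 < Ls) (hP : 0 < P) :
    (∀ G G' : ℝ, 0 < G → 0 < G' →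
        skillPremium α β₁ β₂ β₃ γ θ φ K Lu Ls P G =
          skillPremium α β₁ β₂ β₃ γ θ φ K Lu Ls P G') ∧
      (∀ G : ℝ, 0 < G →
        deriv (skillPremium α β₁ β₂ β₃ γ θ φ K Lu Ls P) G = 0) := by
  subst hγφ
  have key := fun G hG => skillPremium_closed α β₁ β₂ β₃ θ γ hα1 hβ₁ hβ₁1 hβ₂ hβ₂1 hβ₃ hβ₃1 hγ
    K Lu Ls P G hK hLu hLs hP hG
  refine ⟨fun G G' hG hG' => by rw [key G hG, key G' hG'], fun G hG => ?_⟩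
  have hev := Filter.eventually_of_mem (Ioi_mem_nhds hG) key
  rw [Filter.EventuallyEq.deriv_eq hev]
  simp
end

section
/- Suppose γ < φ. Then for fixed K, L_u, L_s, P > 0, the skill premium w_s/w_u is a strictly decreasing function of G on (0, ∞): for all 0 < G < G', the skill premium at G' is strictly smaller than the skill premium at G. -/
open Real

/-- Derivative of a nested CES aggregate in one inner input. -/
lemma ces_deriv_aux (C m B c a D ρ γ x : ℝ) (hB : 0 < B) (hc : 0 < c) (ha : 0 < a)
    (hD : 0 < D) (hρ : 0 < ρ) (hγ : 0 < γ) (hx : 0 < x) :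
    HasDerivAt (fun x : ℝ => C * (B + c * (a * x ^ ρ + D) ^ (γ / ρ)) ^ (m / γ))
      (C * m * (B + c * (a * x ^ ρ + D) ^ (γ / ρ)) ^ (m / γ - 1) *
        (c * a * x ^ (ρ - 1) * (a * x ^ ρ + D) ^ (γ / ρ - 1))) x := by
  have hxp : 0 < x ^ ρ := rpow_pos_of_pos hx ρ
  have hin : 0 < a * x ^ ρ + D := by positivity
  have hinp : 0 < (a * x ^ ρ + D) ^ (γ / ρ) := rpow_pos_of_pos hin _
  have hout : 0 < B + c * (a * x ^ ρ + D) ^ (γ / ρ) := by positivity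
  have h1 : HasDerivAt (fun x : ℝ => x ^ ρ) (ρ * x ^ (ρ - 1)) x :=
    Real.hasDerivAt_rpow_const (Or.inl hx.ne')
  have h2 := (h1.const_mul a).add_const D
  have h3 := h2.rpow_const (p := γ / ρ) (Or.inl hin.ne')
  have h4 := (h3.const_mul c).const_add B
  have h5 := (h4.rpow_const (p := m / γ) (Or.inl hout.ne')).const_mul C
  refine h5.congr_deriv ?_
  field_simp

/-- If `γ < φ`, the skill premium is a strictly decreasing function of the AI stock `G`
on `(0, ∞)`: for all `0 < G < G'`, the skill premium at `G'` is strictly smaller than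
the skill premium at `G`. -/
theorem skill_premium_strictAnti
    (α β₁ β₂ β₃ γ θ φ : ℝ)
(hα : 0 < α) (hα1 : α < 1)
    (hβ₁ : 0 < β₁) (hβ₁1 : β₁ < 1)
    (hβ₂ : 0 < β₂) (hβ₂1 : β₂ < 1)
    (hβ₃ : 0 < β₃) (hβ₃1 : β₃ < 1)
    (hγ : 0 < γ) (hγ1 : γ ≤ 1)
    (hθ : 0 < θ) (hθ1 : θ ≤ 1)
    (hφ : 0 < φ) (hφ1 : φ ≤ 1)
    (hγφ : γ < φ)
    (K Lu Ls P : ℝ)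
    (hK : 0 < K) (hLu : 0 < Lu) (hLs : 0 < Ls) (hP : 0 < P) :
    ∀ G G' : ℝ, 0 < G → G < G' →
      skillPremium α β₁ β₂ β₃ γ θ φ K Lu Ls P G' <
        skillPremium α β₁ β₂ β₃ γ θ φ K Lu Ls P G := by

  have hP' : 0 < P ^ θ := rpow_pos_of_pos hP _
  have hLu' : 0 < Lu ^ θ := rpow_pos_of_pos hLu _
  have hLs' : 0 < Ls ^ φ := rpow_pos_of_pos hLs _
  have h1 : 0 < 1 - β₁ := by linarith
  have h2 : 0 < 1 - β₂ := by linarith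
  have h3 : 0 < 1 - β₃ := by linarith
  have hm : 0 < 1 - α := by linarith
  have hU : 0 < β₁ * Lu ^ θ + (1 - β₁) * P ^ θ := by positivity
  have hUp : ∀ p : ℝ, 0 < (β₁ * Lu ^ θ + (1 - β₁) * P ^ θ) ^ p := fun p => rpow_pos_of_pos hU p
  have hLu1 : 0 < Lu ^ (θ - 1) := rpow_pos_of_pos hLu _
  have hLs1 : 0 < Ls ^ (φ - 1) := rpow_pos_of_pos hLs _
  have hKα : 0 < K ^ α := rpow_pos_of_pos hK _
  have hden : 0 < β₃ * β₁ * Lu ^ (θ - 1) *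
      (β₁ * Lu ^ θ + (1 - β₁) * P ^ θ) ^ (γ / θ - 1) := by
    have := hUp (γ / θ - 1)
    positivity
  have key : ∀ G : ℝ, 0 < G → skillPremium α β₁ β₂ β₃ γ θ φ K Lu Ls P G =
      ((1 - β₃) * β₂ * Ls ^ (φ - 1) * (β₂ * Ls ^ φ + (1 - β₂) * G ^ φ) ^ (γ / φ - 1)) /
      (β₃ * β₁ * Lu ^ (θ - 1) * (β₁ * Lu ^ θ + (1 - β₁) * P ^ θ) ^ (γ / θ - 1)) := by
    intro G hG
    have hG' : 0 < G ^ φ := rpow_pos_of_pos hG _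
    have hS : 0 < β₂ * Ls ^ φ + (1 - β₂) * G ^ φ := by positivity
    have hSp : 0 < (β₂ * Ls ^ φ + (1 - β₂) * G ^ φ) ^ (γ / φ) := rpow_pos_of_pos hS _
    have hUq := hUp (γ / θ)
    have ds := ces_deriv_aux (K ^ α) (1 - α)
      (β₃ * (β₁ * Lu ^ θ + (1 - β₁) * P ^ θ) ^ (γ / θ)) (1 - β₃) β₂ ((1 - β₂) * G ^ φ) φ γ Ls
      (by positivity) h3 hβ₂ (by positivity) hφ hγ hLs
    have du := ces_deriv_aux (K ^ α) (1 - α)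
      ((1 - β₃) * (β₂ * Ls ^ φ + (1 - β₂) * G ^ φ) ^ (γ / φ)) β₃ β₁ ((1 - β₁) * P ^ θ) θ γ Lu
      (by positivity) hβ₃ hβ₁ (by positivity) hθ hγ hLu
    have eu : (fun x => Y α β₁ β₂ β₃ γ θ φ K x Ls P G) = fun x : ℝ =>
        K ^ α * ((1 - β₃) * (β₂ * Ls ^ φ + (1 - β₂) * G ^ φ) ^ (γ / φ) +
          β₃ * (β₁ * x ^ θ + (1 - β₁) * P ^ θ) ^ (γ / θ)) ^ ((1 - α) / γ) := by
      funext x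
      unfold Y
      rw [add_comm (β₃ * _)]
    unfold skillPremium
    rw [eu, du.deriv]
    have es : deriv (fun x => Y α β₁ β₂ β₃ γ θ φ K Lu x P G) Ls = _ := ds.deriv
    rw [es, add_comm ((1 - β₃) * _) (β₃ * _)]
    apply mul_div_mul_left
    have : 0 < (β₃ * (β₁ * Lu ^ θ + (1 - β₁) * P ^ θ) ^ (γ / θ) +
      (1 - β₃) * (β₂ * Ls ^ φ + (1 - β₂) * G ^ φ) ^ (γ / φ)) ^ ((1 - α) / γ - 1) :=
      rpow_pos_of_pos (by positivity) _
    positivity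
  intro G G' hG hGG'
  rw [key G hG, key G' (hG.trans hGG')]
  have hGp : 0 < G ^ φ := rpow_pos_of_pos hG _
  have hlt : G ^ φ < G' ^ φ := rpow_lt_rpow hG.le hGG' hφ
  have hexp : γ / φ - 1 < 0 := by
    rw [sub_neg, div_lt_one hφ]
    exact hγφ
  apply div_lt_div_of_pos_right _ hden
  apply mul_lt_mul_of_pos_left _ (by positivity)
  apply rpow_lt_rpow_of_neg (by positivity) _ hexp
  have := mul_lt_mul_of_pos_left hlt h2
  linarith
end

section
/- Suppose γ > φ (with γ, φ ∈ (0,1]). Then for fixed K, L_u, L_s, P > 0, the derivative of the skill premium w_s/w_u with respect to G is strictly positive at every G > 0; i.e., increasing use of AI raises the skill premium when AI is less substitutable for high-skill workers than low-skill workers are for high-skill workers. -/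
open Real

/-- Derivative of a nested CES expression in one input. -/
lemma nested_hasDerivAt (k c d b m t p q x : ℝ) (hc : 0 < c) (hd : 0 < d) (hb : 0 < b)
    (hm : 0 < m) (hx : 0 < x) :
    HasDerivAt (fun x : ℝ => k * (c + d * (b * x ^ t + m) ^ p) ^ q)
      (k * (d * (b * (t * x ^ (t - 1)) * p * (b * x ^ t + m) ^ (p - 1)) * q *
        (c + d * (b * x ^ t + m) ^ p) ^ (q - 1))) x := by
  have hxt : 0 < x ^ t := Real.rpow_pos_of_pos hx t
  have hB : 0 < b * x ^ t + m := by positivity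
  have hBp : 0 < (b * x ^ t + m) ^ p := Real.rpow_pos_of_pos hB p
  have h1 : HasDerivAt (fun x : ℝ => x ^ t) (t * x ^ (t - 1)) x :=
    Real.hasDerivAt_rpow_const (Or.inl hx.ne')
  have h2 := ((h1.const_mul b).add_const m).rpow_const (p := p) (Or.inl hB.ne')
  have hX : c + d * (b * x ^ t + m) ^ p ≠ 0 := by positivity
  exact (((h2.const_mul d).const_add c).rpow_const (p := q) (Or.inl hX)).const_mul k

/-- If `γ > φ` (AI is less substitutable for high-skill workers than low-skill workers
are for high-skill workers), then increasing use of AI raises the skill premium: its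
derivative with respect to `G` is strictly positive at every `G > 0`. -/
theorem skill_premium_increasing_in_AI
    (α β₁ β₂ β₃ γ θ φ : ℝ)
(hα : 0 < α) (hα1 : α < 1)
    (hβ₁ : 0 < β₁) (hβ₁1 : β₁ < 1)
    (hβ₂ : 0 < β₂) (hβ₂1 : β₂ < 1)
    (hβ₃ : 0 < β₃) (hβ₃1 : β₃ < 1)
    (hγ : 0 < γ) (hγ1 : γ ≤ 1)
    (hθ : 0 < θ) (hθ1 : θ ≤ 1)
    (hφ : 0 < φ) (hφ1 : φ ≤ 1)
    (hγφ : φ < γ)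
    (K Lu Ls P : ℝ)
    (hK : 0 < K) (hLu : 0 < Lu) (hLs : 0 < Ls) (hP : 0 < P) :
    ∀ G : ℝ, 0 < G →
      0 < deriv (skillPremium α β₁ β₂ β₃ γ θ φ K Lu Ls P) G := by
  have h1 : 0 < 1 - β₁ := by linarith
  have h2 : 0 < 1 - β₂ := by linarith
  have h3 : 0 < 1 - β₃ := by linarith
  have h4 : 0 < 1 - α := by linarith
  intro G hG
  have hA : 0 < β₁ * Lu ^ θ + (1 - β₁) * P ^ θ := by positivity
  set C : ℝ := ((1 - β₃) * (β₂ * (φ * Ls ^ (φ - 1)) * (γ / φ))) /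
    (β₃ * (β₁ * (θ * Lu ^ (θ - 1)) * (γ / θ) *
      (β₁ * Lu ^ θ + (1 - β₁) * P ^ θ) ^ (γ / θ - 1))) with hC
  have hCpos : 0 < C := by rw [hC]; positivity
  have key : ∀ g : ℝ, 0 < g → skillPremium α β₁ β₂ β₃ γ θ φ K Lu Ls P g =
      C * ((1 - β₂) * g ^ φ + β₂ * Ls ^ φ) ^ (γ / φ - 1) := by
    intro g hg
    have hB : 0 < β₂ * Ls ^ φ + (1 - β₂) * g ^ φ := by positivity
    have e1 := (nested_hasDerivAt (K ^ α)
      (β₃ * (β₁ * Lu ^ θ + (1 - β₁) * P ^ θ) ^ (γ / θ)) (1 - β₃) β₂ ((1 - β₂) * g ^ φ)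
      φ (γ / φ) ((1 - α) / γ) Ls (by positivity) h3 hβ₂ (by positivity) hLs).deriv
    have e2 := (nested_hasDerivAt (K ^ α)
      ((1 - β₃) * (β₂ * Ls ^ φ + (1 - β₂) * g ^ φ) ^ (γ / φ)) β₃ β₁ ((1 - β₁) * P ^ θ)
      θ (γ / θ) ((1 - α) / γ) Lu (by positivity) hβ₃ hβ₁ (by positivity) hLu).deriv
    have e3 : (fun x => Y α β₁ β₂ β₃ γ θ φ K x Ls P g) = fun x : ℝ => K ^ α *
        ((1 - β₃) * (β₂ * Ls ^ φ + (1 - β₂) * g ^ φ) ^ (γ / φ) +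
          β₃ * (β₁ * x ^ θ + (1 - β₁) * P ^ θ) ^ (γ / θ)) ^ ((1 - α) / γ) := by
      funext x
      rw [Y, add_comm (β₃ * _)]
    unfold skillPremium
    rw [e3, e2]
    simp only [Y]
    rw [e1, add_comm ((1 - β₃) * _) (β₃ * _), add_comm ((1 - β₂) * g ^ φ), hC]
    have hX : 0 < (β₃ * (β₁ * Lu ^ θ + (1 - β₁) * P ^ θ) ^ (γ / θ) +
      (1 - β₃) * (β₂ * Ls ^ φ + (1 - β₂) * g ^ φ) ^ (γ / φ)) ^ ((1 - α) / γ - 1) := by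
      positivity
    have hU : 0 < (β₁ * Lu ^ θ + (1 - β₁) * P ^ θ) ^ (γ / θ - 1) := by positivity
    have hKα : 0 < K ^ α := by positivity
    have hLt : 0 < Lu ^ (θ - 1) := by positivity
    generalize (β₃ * (β₁ * Lu ^ θ + (1 - β₁) * P ^ θ) ^ (γ / θ) +
      (1 - β₃) * (β₂ * Ls ^ φ + (1 - β₂) * g ^ φ) ^ (γ / φ)) ^ ((1 - α) / γ - 1) = X at *
    generalize (β₁ * Lu ^ θ + (1 - β₁) * P ^ θ) ^ (γ / θ - 1) = U at *
    generalize (β₂ * Ls ^ φ + (1 - β₂) * g ^ φ) ^ (γ / φ - 1) = V at *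
    generalize Lu ^ (θ - 1) = W at *
    generalize Ls ^ (φ - 1) = Z at *
    generalize K ^ α = k at *
    have hq : 0 < (1 - α) / γ := by positivity
    have hr : 0 < γ / θ := by positivity
    generalize (1 - α) / γ = q at *
    generalize γ / θ = r at *
    generalize γ / φ = s at *
    rw [div_mul_eq_mul_div, div_eq_div_iff (by positivity) (by positivity)]
    ring
  have hev : skillPremium α β₁ β₂ β₃ γ θ φ K Lu Ls P =ᶠ[nhds G]
      fun g => C * ((1 - β₂) * g ^ φ + β₂ * Ls ^ φ) ^ (γ / φ - 1) := by
    filter_upwards [lt_mem_nhds hG] with g hg using key g hg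
  have hB : 0 < (1 - β₂) * G ^ φ + β₂ * Ls ^ φ := by positivity
  have d1 : HasDerivAt (fun x : ℝ => x ^ φ) (φ * G ^ (φ - 1)) G :=
    Real.hasDerivAt_rpow_const (Or.inl hG.ne')
  have d2 := (((d1.const_mul (1 - β₂)).add_const (β₂ * Ls ^ φ)).rpow_const
    (p := γ / φ - 1) (Or.inl hB.ne')).const_mul C
  rw [hev.deriv_eq, d2.deriv]
  have hr : 0 < γ / φ - 1 := by
    rw [sub_pos, one_lt_div hφ]
    exact hγφ
  generalize hpe : γ / φ - 1 = e at *
  positivity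
end

section
/- (Appendix) In the model without AI, for all K, L_u, L_s, P > 0, the partial derivative of the high-skill wage w_s = ∂Ŷ/∂L_s with respect to P equals (1−α) · Ŷ · (1−β)β L_s^γ / [L_s (P + L_u)^{1−γ}] · (1−α−γ) / [(1−β) L_s^γ + β(P + L_u)^γ]². -/
open Real

/-- The production function without AI from the appendix. All powers are real powers. -/
noncomputable def Yhat (α β γ K Lu Ls P : ℝ) : ℝ :=
  ((1 - β) * Ls ^ γ + β * (P + Lu) ^ γ) ^ ((1 - α) / γ) * K ^ α

/-- In the model without AI, the effect of an increase in the stock of automation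
capital `P` on the high-skill wage `w_s = ∂Ŷ/∂L_s` is given by the closed-form
expression from the appendix. -/
theorem deriv_high_skill_wage_robots_formula
    (α β γ : ℝ)
    (hα : 0 < α) (hα1 : α < 1)
    (hβ : 0 < β) (hβ1 : β < 1)
    (hγ : 0 < γ) (hγ1 : γ ≤ 1)
    (K Lu Ls P : ℝ)
    (hK : 0 < K) (hLu : 0 < Lu) (hLs : 0 < Ls) (hP : 0 < P) :
    deriv (fun p => deriv (fun x => Yhat α β γ K Lu x p) Ls) P =
      (1 - α) * Yhat α β γ K Lu Ls P *
        ((1 - β) * β * Ls ^ γ / (Ls * (P + Lu) ^ (1 - γ))) *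
        ((1 - α - γ) / ((1 - β) * Ls ^ γ + β * (P + Lu) ^ γ) ^ 2) := by
  have key : ∀ p : ℝ, 0 < p → deriv (fun x => Yhat α β γ K Lu x p) Ls =
      ((1 - β) * (γ * Ls ^ (γ - 1))) * ((1 - α) / γ) *
        ((1 - β) * Ls ^ γ + β * (p + Lu) ^ γ) ^ ((1 - α) / γ - 1) * K ^ α := by
    intro p hp
    have hb : 0 < 1 - β := by linarith
    have hq : 0 < p + Lu := by linarith
    have hD : 0 < (1 - β) * Ls ^ γ + β * (p + Lu) ^ γ := by positivity
    have h1 : HasDerivAt (fun x : ℝ => x ^ γ) (γ * Ls ^ (γ - 1)) Ls :=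
      Real.hasDerivAt_rpow_const (Or.inl hLs.ne')
    have h2 := (h1.const_mul (1 - β)).add_const (β * (p + Lu) ^ γ)
    have h3 := (h2.rpow_const (p := (1 - α) / γ) (Or.inl hD.ne')).mul_const (K ^ α)
    exact h3.deriv
  have hev : (fun p => deriv (fun x => Yhat α β γ K Lu x p) Ls) =ᶠ[nhds P]
      (fun p => ((1 - β) * (γ * Ls ^ (γ - 1))) * ((1 - α) / γ) *
        ((1 - β) * Ls ^ γ + β * (p + Lu) ^ γ) ^ ((1 - α) / γ - 1) * K ^ α) := by
    filter_upwards [lt_mem_nhds hP] with p hp using key p hp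
  rw [hev.deriv_eq]
  have hb : 0 < 1 - β := by linarith
  have hq : 0 < P + Lu := by linarith
  have hD : 0 < (1 - β) * Ls ^ γ + β * (P + Lu) ^ γ := by positivity
  have h0 : HasDerivAt (fun p : ℝ => p + Lu) 1 P := (hasDerivAt_id P).add_const Lu
  have h1 := h0.rpow_const (p := γ) (Or.inl hq.ne')
  have h2 := (h1.const_mul β).const_add ((1 - β) * Ls ^ γ)
  have h3 := ((h2.rpow_const (p := (1 - α) / γ - 1) (Or.inl hD.ne')).const_mul
    (((1 - β) * (γ * Ls ^ (γ - 1))) * ((1 - α) / γ))).mul_const (K ^ α)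
  refine h3.deriv.trans ?_
  unfold Yhat
  have e1 : (P + Lu) ^ (1 - γ) = (P + Lu) / (P + Lu) ^ γ := by
    rw [Real.rpow_sub hq, Real.rpow_one]
  have hLg : 0 < Ls ^ γ := by positivity
  have hqg : 0 < (P + Lu) ^ γ := by positivity
  rw [e1, Real.rpow_sub_one hLs.ne', Real.rpow_sub_one hq.ne',
    Real.rpow_sub_one hD.ne', Real.rpow_sub_one hD.ne']
  generalize (P + Lu) ^ γ = B at *
  generalize Ls ^ γ = A at *
  generalize ((1 - β) * A + β * B) ^ ((1 - α) / γ) = Z at *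
  generalize (1 - β) * A + β * B = D at *
  field_simp
end

section
/- (Appendix) In the model without AI, for all K, L_u, L_s, P > 0: the partial derivative ∂w_s/∂P of the high-skill wage with respect to the stock of industrial robots is nonnegative if 1 − α ≥ γ and strictly negative if 1 − α < γ; moreover it is strictly positive if 1 − α > γ and zero if 1 − α = γ. -/
open Real

/-- In the model without AI, the sign of `∂w_s/∂P` is determined by the comparison of
`1 - α` with `γ`: it is nonnegative if `1 - α ≥ γ`, strictly negative if `1 - α < γ`,
strictly positive if `1 - α > γ`, and zero if `1 - α = γ`. -/
theorem deriv_high_skill_wage_robots_sign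
    (α β γ : ℝ)
    (hα : 0 < α) (hα1 : α < 1)
    (hβ : 0 < β) (hβ1 : β < 1)
    (hγ : 0 < γ) (hγ1 : γ ≤ 1)
    (K Lu Ls P : ℝ)
    (hK : 0 < K) (hLu : 0 < Lu) (hLs : 0 < Ls) (hP : 0 < P) :
    (1 - α ≥ γ → 0 ≤ deriv (fun p => deriv (fun x => Yhat α β γ K Lu x p) Ls) P) ∧
      (1 - α < γ → deriv (fun p => deriv (fun x => Yhat α β γ K Lu x p) Ls) P < 0) ∧
      (1 - α > γ → 0 < deriv (fun p => deriv (fun x => Yhat α β γ K Lu x p) Ls) P) ∧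
      (1 - α = γ → deriv (fun p => deriv (fun x => Yhat α β γ K Lu x p) Ls) P = 0) := by
  have hS : ∀ p : ℝ, 0 < p → 0 < (1 - β) * Ls ^ γ + β * (p + Lu) ^ γ := by
    intro p hp
    have h1 : 0 < 1 - β := by linarith
    have h2 : 0 < p + Lu := by linarith
    positivity
  have hw : ∀ p : ℝ, 0 < p → deriv (fun x => Yhat α β γ K Lu x p) Ls =
      (1 - β) * (γ * Ls ^ (γ - 1)) * ((1 - α) / γ) *
        ((1 - β) * Ls ^ γ + β * (p + Lu) ^ γ) ^ ((1 - α) / γ - 1) * K ^ α := by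
    intro p hp
    have h1 : HasDerivAt (fun x : ℝ => x ^ γ) (γ * Ls ^ (γ - 1)) Ls :=
      Real.hasDerivAt_rpow_const (Or.inl hLs.ne')
    have h2 := (h1.const_mul (1 - β)).add_const (β * (p + Lu) ^ γ)
    have h3 := (h2.rpow_const (p := (1 - α) / γ) (Or.inl (hS p hp).ne')).mul_const (K ^ α)
    exact h3.deriv
  have hev : (fun p => deriv (fun x => Yhat α β γ K Lu x p) Ls) =ᶠ[nhds P]
      (fun p => (1 - β) * (γ * Ls ^ (γ - 1)) * ((1 - α) / γ) *
        ((1 - β) * Ls ^ γ + β * (p + Lu) ^ γ) ^ ((1 - α) / γ - 1) * K ^ α) := by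
    filter_upwards [lt_mem_nhds hP] with p hp
    exact hw p hp
  have hPL : 0 < P + Lu := by linarith
  have hD : deriv (fun p => deriv (fun x => Yhat α β γ K Lu x p) Ls) P =
      ((1 - β) * (γ * Ls ^ (γ - 1)) * ((1 - α) / γ) * (β * (γ * (P + Lu) ^ (γ - 1))) *
        ((1 - β) * Ls ^ γ + β * (P + Lu) ^ γ) ^ ((1 - α) / γ - 1 - 1) * K ^ α / γ) *
        (1 - α - γ) := by
    rw [hev.deriv_eq]
    have h0 : HasDerivAt (fun p : ℝ => p + Lu) 1 P := (hasDerivAt_id P).add_const Lu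
    have h1 := h0.rpow_const (p := γ) (Or.inl hPL.ne')
    have h2 := (h1.const_mul β).const_add ((1 - β) * Ls ^ γ)
    have h3 := ((h2.rpow_const (p := (1 - α) / γ - 1) (Or.inl (hS P hP).ne')).const_mul
      ((1 - β) * (γ * Ls ^ (γ - 1)) * ((1 - α) / γ))).mul_const (K ^ α)
    refine h3.deriv.trans ?_
    have he : (1 - α) / γ - 1 = (1 - α - γ) / γ := by field_simp
    generalize ((1 - β) * Ls ^ γ + β * (P + Lu) ^ γ) ^ ((1 - α) / γ - 1 - 1) = T
    rw [he]
    ring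
  rw [hD]
  have hC : 0 < (1 - β) * (γ * Ls ^ (γ - 1)) * ((1 - α) / γ) * (β * (γ * (P + Lu) ^ (γ - 1))) *
        ((1 - β) * Ls ^ γ + β * (P + Lu) ^ γ) ^ ((1 - α) / γ - 1 - 1) * K ^ α / γ := by
    have h1 : 0 < 1 - β := by linarith
    have h2 : 0 < 1 - α := by linarith
    have h3 := Real.rpow_pos_of_pos (hS P hP) ((1 - α) / γ - 1 - 1)
    positivity
  refine ⟨fun h => mul_nonneg hC.le (by linarith), fun h => mul_neg_of_pos_of_neg hC (by linarith),
    fun h => mul_pos hC (by linarith), fun h => by rw [h]; simp⟩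
end
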